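/- If two mixture measures share the same mixing distribution, i.e. P = ∫ μ_c dΛ(c) and Q = ∫ ν_c dΛ(c) over a parameter c with common mixing measure Λ, then W_p^p(P, Q) ≤ ∫ W_p^p(μ_c, ν_c) dΛ(c). That is, the p-th power of the Wasserstein distance between mixtures with a common mixing measure is bounded by the average of the p-th powers of the componentwise Wasserstein distances. -/

import Mathlib

open MeasureTheory ENNReal

/-- The `p`-Wasserstein distance between two measures on `ℝ`, defined as the infimum
over couplings of the `p`-th moment of the distance, raised to the power `1/p`. -/
noncomputable def Wp (p : ℝ) (μ ν : MeasureTheory.Measure ℝ) : ℝ≥0∞ :=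
  (⨅ π ∈ {π : MeasureTheory.Measure (ℝ × ℝ) |
      π.map Prod.fst = μ ∧ π.map Prod.snd = ν},
    ∫⁻ q, (edist q.1 q.2) ^ p ∂π) ^ (1 / p)

open ProbabilityTheory Set

lemma wmb_kernel (p : ℝ) (hp : 1 ≤ p) : ∃ m : Measure ℝ, SFinite m ∧
    ∀ t : ℝ, ∫⁻ r, ENNReal.ofReal (t - r) ∂m = (ENNReal.ofReal t) ^ p := by
  rcases hp.eq_or_lt with rfl | hp
  · refine ⟨Measure.dirac 0, inferInstance, fun t => ?_⟩
    simp
  · refine ⟨(volume.restrict (Ioi 0)).withDensity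
      (fun r => ENNReal.ofReal (p * (p - 1) * r ^ (p - 2))), inferInstance, fun t => ?_⟩
    rw [lintegral_withDensity_eq_lintegral_mul _ (by fun_prop) (by fun_prop)]
    rcases le_or_gt t 0 with ht | ht
    · rw [ENNReal.ofReal_of_nonpos ht, ENNReal.zero_rpow_of_pos (by linarith)]
      rw [setLIntegral_congr_fun (g := fun _ => 0) measurableSet_Ioi]
      · simp
      · intro r hr
        have hr : 0 < r := hr
        simp only [Pi.mul_apply]
        rw [ENNReal.ofReal_of_nonpos (p := t - r) (by linarith), mul_zero]
    · have h1 : ∫⁻ r in Ioi (0:ℝ), ((fun r => ENNReal.ofReal (p * (p - 1) * r ^ (p - 2))) *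
          fun r => ENNReal.ofReal (t - r)) r
          = ∫⁻ r in Ioc 0 t, ENNReal.ofReal (p * (p - 1) * (t * r ^ (p - 2) - r ^ (p - 1))) := by
        rw [← Ioc_union_Ioi_eq_Ioi ht.le, lintegral_union measurableSet_Ioi
          (Set.disjoint_left.2 fun x hx hx' => not_lt.2 hx.2 hx')]
        rw [setLIntegral_congr_fun (s := Ioi t) (g := fun _ => 0) measurableSet_Ioi]
        · simp only [lintegral_zero, add_zero]
          refine setLIntegral_congr_fun measurableSet_Ioc fun r hr => ?_
          simp only [Pi.mul_apply]
          have := Real.rpow_nonneg hr.1.le (p - 2)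
          rw [← ENNReal.ofReal_mul (mul_nonneg (by nlinarith) this)]
          congr 1
          have : r ^ (p - 1) = r ^ (p - 2) * r := by
            rw [← Real.rpow_add_one hr.1.ne']; congr 1; ring
          rw [this]; ring
        · intro r hr
          have hr : t < r := hr
          simp only [Pi.mul_apply]
          rw [ENNReal.ofReal_of_nonpos (p := t - r) (by linarith), mul_zero]
      have i1 : IntervalIntegrable (fun r : ℝ => r ^ (p - 2)) volume 0 t :=
        intervalIntegral.intervalIntegrable_rpow' (by linarith)
      have i2 : IntervalIntegrable (fun r : ℝ => r ^ (p - 1)) volume 0 t :=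
        intervalIntegral.intervalIntegrable_rpow' (by linarith)
      have i3 := (((i1.const_mul t).sub i2).const_mul (p * (p - 1)))
      rw [h1, ← ofReal_integral_eq_lintegral_ofReal
        ((intervalIntegrable_iff_integrableOn_Ioc_of_le ht.le).1 i3),
        ← intervalIntegral.integral_of_le ht.le,
        intervalIntegral.integral_const_mul, intervalIntegral.integral_sub (i1.const_mul t) i2,
        intervalIntegral.integral_const_mul, integral_rpow (Or.inl (by linarith)),
        integral_rpow (Or.inl (by linarith)), ENNReal.ofReal_rpow_of_pos ht]
      · congr 1
        have e1 : p - 2 + 1 = p - 1 := by ring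
        have e2 : p - 1 + 1 = p := by ring
        have e3 : t ^ p = t ^ (p - 1) * t := by
          rw [← Real.rpow_add_one ht.ne']; congr 1; ring
        rw [e1, e2, Real.zero_rpow (by linarith), Real.zero_rpow (by linarith), e3]
        have : p - 1 ≠ 0 := by linarith
        have : p ≠ 0 := by linarith
        field_simp
        ring
      · refine (ae_restrict_iff' measurableSet_Ioc).2 (Filter.Eventually.of_forall fun r hr => ?_)
        have := Real.rpow_nonneg hr.1.le (p - 2)
        have e : r ^ (p - 1) = r ^ (p - 2) * r := by
          rw [← Real.rpow_add_one hr.1.ne']; congr 1; ring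
        simp only [Pi.zero_apply]
        rw [e]
        have h2 : 0 ≤ r ^ (p - 2) * (t - r) := mul_nonneg this (by linarith [hr.2])
        exact mul_nonneg (by nlinarith) (by linarith)

lemma wmb_tonelli {α : Type*} [MeasurableSpace α] (P : Measure α) [SFinite P]
    (f g : α → ℝ) (hf : Measurable f) (hg : Measurable g) (p : ℝ) (m : Measure ℝ) [SFinite m]
    (hm : ∀ t : ℝ, ∫⁻ r, ENNReal.ofReal (t - r) ∂m = (ENNReal.ofReal t) ^ p) :
    ∫⁻ a, ENNReal.ofReal (g a - f a) ^ p ∂P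
      = ∫⁻ r, ∫⁻ s, P {a | f a ≤ s ∧ s + r < g a} ∂volume ∂m := by
  simp_rw [← hm]
  rw [lintegral_lintegral_swap (by fun_prop)]
  refine lintegral_congr fun r => ?_
  have hS : MeasurableSet {q : α × ℝ | f q.1 ≤ q.2 ∧ q.2 + r < g q.1} :=
    MeasurableSet.inter (s₁ := {q : α × ℝ | f q.1 ≤ q.2}) (s₂ := {q : α × ℝ | q.2 + r < g q.1})
      (measurableSet_le (by fun_prop) (by fun_prop))
      (measurableSet_lt (by fun_prop) (by fun_prop))
  have h1 := Measure.prod_apply (μ := P) (ν := volume) hS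
  have h2 := Measure.prod_apply_symm (μ := P) (ν := volume) hS
  have : ∀ a, ENNReal.ofReal (g a - f a - r) =
      volume (Prod.mk a ⁻¹' {q : α × ℝ | f q.1 ≤ q.2 ∧ q.2 + r < g q.1}) := by
    intro a
    have : Prod.mk a ⁻¹' {q : α × ℝ | f q.1 ≤ q.2 ∧ q.2 + r < g q.1} = Ico (f a) (g a - r) := by
      ext s; simp [lt_sub_iff_add_lt]
    rw [this, Real.volume_Ico]; congr 1; ring
  simp_rw [this]
  rw [← h1, h2]
  rfl

lemma wmb_edist (p : ℝ) (hp : 1 ≤ p) (x y : ℝ) :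
    edist x y ^ p = ENNReal.ofReal (y - x) ^ p + ENNReal.ofReal (x - y) ^ p := by
  have h0 : (0 : ℝ≥0∞) ^ p = 0 := ENNReal.zero_rpow_of_pos (by linarith)
  rw [edist_dist, Real.dist_eq]
  rcases le_total x y with h | h
  · rw [abs_of_nonpos (by linarith), ENNReal.ofReal_of_nonpos (p := x - y) (by linarith), h0,
      add_zero, neg_sub]
  · rw [abs_of_nonneg (by linarith), ENNReal.ofReal_of_nonpos (p := y - x) (by linarith), h0,
      zero_add]

open Classical in
/-- Quantile function. -/
noncomputable def wmbQ (μ : Measure ℝ) (u : ℝ) : ℝ :=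
  if u ∈ Ioo (0:ℝ) 1 then sInf {x | u ≤ cdf μ x} else 0

lemma wmbQ_le (μ : Measure ℝ) (u : ℝ) (hu : u ∈ Ioo (0:ℝ) 1) (x : ℝ) :
    wmbQ μ u ≤ x ↔ u ≤ cdf μ x := by
  have hne : {x | u ≤ cdf μ x}.Nonempty :=
    (((tendsto_cdf_atTop μ).eventually (lt_mem_nhds hu.2)).exists).imp fun _ h => le_of_lt h
  have hbd : BddBelow {x | u ≤ cdf μ x} := by
    obtain ⟨b, hb⟩ := ((tendsto_cdf_atBot μ).eventually (gt_mem_nhds hu.1)).exists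
    refine ⟨b, fun x hx => ?_⟩
    by_contra! h
    exact absurd (hx.trans (monotone_cdf μ h.le)) (not_le.2 hb)
  rw [wmbQ, if_pos hu]
  constructor
  · intro h
    refine le_trans ?_ (monotone_cdf μ h)
    rw [← StieltjesFunction.iInf_Ioi_eq]
    refine le_ciInf fun r => ?_
    obtain ⟨s, hs, hsr⟩ := exists_lt_of_csInf_lt hne r.2
    exact le_trans hs (monotone_cdf μ hsr.le)
  · intro h
    exact csInf_le hbd h

lemma wmbQ_meas {C : Type*} [MeasurableSpace C] (μc : C → Measure ℝ) (h : Measurable μc)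
    (hμ : ∀ c, IsProbabilityMeasure (μc c)) :
    Measurable fun q : C × ℝ => wmbQ (μc q.1) q.2 := by
  refine measurable_of_Iic fun x => ?_
  have hF : Measurable fun c => cdf (μc c) x := by
    simp_rw [cdf_eq_real, measureReal_def]
    exact ((Measure.measurable_coe measurableSet_Iic).comp h).ennreal_toReal
  have : (fun q : C × ℝ => wmbQ (μc q.1) q.2) ⁻¹' Iic x =
      ({q : C × ℝ | q.2 ∈ Ioo (0:ℝ) 1} ∩ {q | q.2 ≤ cdf (μc q.1) x}) ∪
      ({q : C × ℝ | q.2 ∈ Ioo (0:ℝ) 1}ᶜ ∩ {q | 0 ≤ x}) := by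
    ext q
    by_cases hq : q.2 ∈ Ioo (0:ℝ) 1
    · have := wmbQ_le (μc q.1) q.2 hq x
      simp only [mem_preimage, mem_Iic, mem_union, mem_inter_iff, mem_compl_iff, mem_ofPred_eq]
      tauto
    · have : wmbQ (μc q.1) q.2 = 0 := by rw [wmbQ, if_neg hq]
      simp only [mem_preimage, mem_Iic, mem_union, mem_inter_iff, mem_compl_iff, mem_ofPred_eq, this]
      tauto
  rw [this]
  have hI : MeasurableSet {q : C × ℝ | q.2 ∈ Ioo (0:ℝ) 1} := measurable_snd measurableSet_Ioo
  exact (hI.inter (measurableSet_le measurable_snd (hF.comp measurable_fst))).union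
    (hI.compl.inter (MeasurableSet.const _))

lemma wmbQ_meas' (μ : Measure ℝ) [IsProbabilityMeasure μ] : Measurable (wmbQ μ) :=
  (wmbQ_meas (C := Unit) (fun _ => μ) measurable_const (fun _ => inferInstance)).comp
    (measurable_const.prodMk measurable_id : Measurable fun u : ℝ => ((), u))

lemma wmbQ_map (μ : Measure ℝ) [IsProbabilityMeasure μ] :
    (volume.restrict (Ioo (0:ℝ) 1)).map (wmbQ μ) = μ := by
  refine Measure.ext_of_Iic _ _ fun x => ?_
  rw [Measure.map_apply (wmbQ_meas' μ) measurableSet_Iic,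
    Measure.restrict_apply (wmbQ_meas' μ measurableSet_Iic)]
  have : wmbQ μ ⁻¹' Iic x ∩ Ioo 0 1 = Iic (cdf μ x) ∩ Ioo 0 1 := by
    ext u
    simp only [mem_inter_iff, mem_preimage, mem_Iic]
    exact and_congr_left fun hu => wmbQ_le μ u hu x
  rw [this, ← Measure.restrict_apply measurableSet_Iic, Measure.restrict_congr_set Ioo_ae_eq_Ioc,
    Measure.restrict_apply measurableSet_Iic]
  have : Iic (cdf μ x) ∩ Ioc 0 1 = Ioc 0 (cdf μ x) := by
    ext u
    have := cdf_le_one μ x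
    simp only [mem_inter_iff, mem_Ioc, mem_Iic]
    constructor
    · rintro ⟨a, b, c⟩; exact ⟨b, a⟩
    · rintro ⟨a, b⟩; exact ⟨b, a, b.trans this⟩
  rw [this, Real.volume_Ioc, sub_zero, ofReal_cdf]

lemma wmb_compare {α : Type*} [MeasurableSpace α] (P : Measure α)
    (f g : α → ℝ) (hf : Measurable f) (hg : Measurable g)
    (μ ν : Measure ℝ) [IsProbabilityMeasure μ] [IsProbabilityMeasure ν]
    (h1 : P.map f = μ) (h2 : P.map g = ν) (s t : ℝ) :
    (volume.restrict (Ioo (0:ℝ) 1)) {u | wmbQ μ u ≤ s ∧ t < wmbQ ν u}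
      ≤ P {a | f a ≤ s ∧ t < g a} := by
  have hm : MeasurableSet {u | wmbQ μ u ≤ s ∧ t < wmbQ ν u} :=
    (measurableSet_le (wmbQ_meas' μ) measurable_const).inter
      (measurableSet_lt measurable_const (wmbQ_meas' ν))
  rw [Measure.restrict_apply hm]
  have hsub : {u | wmbQ μ u ≤ s ∧ t < wmbQ ν u} ∩ Ioo 0 1 ⊆ Ioc (cdf ν t) (cdf μ s) := by
    rintro u ⟨⟨a, b⟩, hu⟩
    refine ⟨?_, (wmbQ_le μ u hu s).1 a⟩
    by_contra! h
    exact absurd ((wmbQ_le ν u hu t).2 h) (not_le.2 b)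
  refine (measure_mono hsub).trans ?_
  rw [Real.volume_Ioc, ENNReal.ofReal_sub _ (cdf_nonneg ν t), ofReal_cdf, ofReal_cdf]
  rw [tsub_le_iff_right, ← h1, ← h2, Measure.map_apply hf measurableSet_Iic,
    Measure.map_apply hg measurableSet_Iic]
  refine le_trans (measure_mono ?_) (measure_union_le _ _)
  intro a ha
  rcases lt_or_ge t (g a) with h | h
  · exact Or.inl ⟨ha, h⟩
  · exact Or.inr h

lemma wmb_opt (p : ℝ) (hp : 1 ≤ p) (μ ν : Measure ℝ) [IsProbabilityMeasure μ]
    [IsProbabilityMeasure ν] (π : Measure (ℝ × ℝ))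
    (h1 : π.map Prod.fst = μ) (h2 : π.map Prod.snd = ν) :
    ∫⁻ u in Ioo (0:ℝ) 1, edist (wmbQ μ u) (wmbQ ν u) ^ p ≤ ∫⁻ q, edist q.1 q.2 ^ p ∂π := by
  obtain ⟨m, _, hm⟩ := wmb_kernel p hp
  have : IsFiniteMeasure π := by
    refine ⟨?_⟩
    have := measure_lt_top μ univ
    rw [← h1, Measure.map_apply measurable_fst MeasurableSet.univ] at this
    simpa using this
  have a1 := wmbQ_meas' μ
  have a2 := wmbQ_meas' ν
  simp_rw [wmb_edist p hp]
  rw [lintegral_add_left (by fun_prop), lintegral_add_left (by fun_prop)]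
  rw [wmb_tonelli _ _ _ a1 a2 p m hm, wmb_tonelli _ _ _ a2 a1 p m hm,
    wmb_tonelli π _ _ measurable_fst measurable_snd p m hm,
    wmb_tonelli π _ _ measurable_snd measurable_fst p m hm]
  refine add_le_add ?_ ?_
  · exact lintegral_mono fun r => lintegral_mono fun s =>
      wmb_compare π _ _ measurable_fst measurable_snd μ ν h1 h2 s (s + r)
  · exact lintegral_mono fun r => lintegral_mono fun s =>
      wmb_compare π _ _ measurable_snd measurable_fst ν μ h2 h1 s (s + r)

lemma wmb_marg {C : Type*} [MeasurableSpace C] (Λ : Measure C) [SFinite Λ]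
    (μc : C → Measure ℝ) (h : Measurable μc)
    (hμ : ∀ c, IsProbabilityMeasure (μc c)) :
    (Λ.prod (volume.restrict (Ioo (0:ℝ) 1))).map (fun q : C × ℝ => wmbQ (μc q.1) q.2)
      = Λ.bind μc := by
  ext A hA
  have hQ := wmbQ_meas μc h hμ
  rw [Measure.map_apply hQ hA, Measure.prod_apply (hQ hA), Measure.bind_apply hA h.aemeasurable]
  refine lintegral_congr fun c => ?_
  conv_rhs => rw [← wmbQ_map (μc c)]
  rw [Measure.map_apply (wmbQ_meas' _) hA]
  rfl

/-- For mixtures with a common mixing measure, the `p`-th power of the Wasserstein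
distance between the mixtures is bounded by the average of the `p`-th powers of the
componentwise Wasserstein distances. -/
theorem wasserstein_mixture_bound {C : Type*} [MeasurableSpace C]
    (p : ℝ) (hp : 1 ≤ p) (Λ : MeasureTheory.Measure C) [IsProbabilityMeasure Λ]
    (μc νc : C → MeasureTheory.Measure ℝ)
    (hμmeas : Measurable μc) (hνmeas : Measurable νc)
    (hμ : ∀ c, IsProbabilityMeasure (μc c)) (hν : ∀ c, IsProbabilityMeasure (νc c))
    (hμm : ∀ c, ∫⁻ x, (‖x‖₊ : ℝ≥0∞) ^ p ∂(μc c) < ∞)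
    (hνm : ∀ c, ∫⁻ x, (‖x‖₊ : ℝ≥0∞) ^ p ∂(νc c) < ∞) :
    Wp p (Λ.bind μc) (Λ.bind νc) ^ p ≤ ∫⁻ c, Wp p (μc c) (νc c) ^ p ∂Λ := by
  have hp0 : p ≠ 0 := by linarith
  have hW : ∀ a : ℝ≥0∞, (a ^ (1 / p)) ^ p = a := fun a => by
    rw [← ENNReal.rpow_mul, one_div, inv_mul_cancel₀ hp0, ENNReal.rpow_one]
  have hQ1 := wmbQ_meas μc hμmeas hμ
  have hQ2 := wmbQ_meas νc hνmeas hν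
  simp only [Wp, hW]
  refine (iInf₂_le ((Λ.prod (volume.restrict (Set.Ioo (0:ℝ) 1))).map
    (fun q : C × ℝ => (wmbQ (μc q.1) q.2, wmbQ (νc q.1) q.2))) ⟨?_, ?_⟩).trans ?_
  · rw [lintegral_map (by fun_prop) (hQ1.prodMk hQ2), lintegral_prod _ (by fun_prop)]
    refine lintegral_mono fun c => le_iInf₂ fun π hπ => ?_
    have := hμ c
    have := hν c
    exact wmb_opt p hp (μc c) (νc c) π hπ.1 hπ.2
  · rw [Measure.map_map measurable_fst (hQ1.prodMk hQ2)]
    exact wmb_marg Λ μc hμmeas hμ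
  · rw [Measure.map_map measurable_snd (hQ1.prodMk hQ2)]
    exact wmb_marg Λ νc hνmeas hν
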